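/- Let μ be a probability measure on ℝ that is absolutely continuous with respect to Lebesgue measure and has finite second moment. Let v₀, v₁ : ℝ → ℝ be Borel measurable, square-integrable with respect to μ, and such that x ↦ x + v₀(x) and x ↦ x + v₁(x) are each nondecreasing on a Borel set of full μ-measure. For t ∈ [0,1] define γ_t as the pushforward of μ by the map x ↦ x + (1−t)v₀(x) + t v₁(x). Then the curve (γ_t) is a constant-speed geodesic: for all s, t ∈ [0,1], d_W²(γ_s, γ_t) = (s − t)² · d_W²(γ_0, γ_1), where d_W² is the squared 2-Wasserstein distance. -/

import Mathlib

open MeasureTheory Set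

/-- Cumulative distribution function of a measure on `ℝ`. -/
noncomputable def cdf (μ : Measure ℝ) (x : ℝ) : ℝ := (μ (Iic x)).toReal

/-- Quantile (generalized inverse cdf) of a measure on `ℝ`. -/
noncomputable def quantile (μ : Measure ℝ) (p : ℝ) : ℝ := sInf {x : ℝ | p ≤ cdf μ x}

/-- Squared 2-Wasserstein distance between measures on `ℝ`, via quantile functions. -/
noncomputable def W2sq (μ ν : Measure ℝ) : ℝ :=
  ∫ α in Ioo (0:ℝ) 1, (quantile μ α - quantile ν α) ^ 2

theorem quantile_le_iff (ν : Measure ℝ) [IsProbabilityMeasure ν] {p : ℝ} (hp : p ∈ Ioo (0 : ℝ) 1)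
    (x : ℝ) : quantile ν p ≤ x ↔ p ≤ cdf ν x := by
  have hF : ∀ x, cdf ν x = ProbabilityTheory.cdf ν x := fun x =>
    (ProbabilityTheory.cdf_eq_real ν x).symm
  simp only [quantile, hF]
  have hmono := ProbabilityTheory.monotone_cdf ν
  have hne : {x : ℝ | p ≤ ProbabilityTheory.cdf ν x}.Nonempty :=
    (((ProbabilityTheory.tendsto_cdf_atTop ν).eventually (lt_mem_nhds hp.2)).exists).imp
      fun _ h => h.le
  have hbdd : BddBelow {x : ℝ | p ≤ ProbabilityTheory.cdf ν x} := by
    obtain ⟨b, hb⟩ :=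
      ((ProbabilityTheory.tendsto_cdf_atBot ν).eventually (gt_mem_nhds hp.1)).exists
    refine ⟨b, fun y hy => ?_⟩
    by_contra! hyb
    exact absurd (hy.trans (hmono hyb.le)) (not_le.2 hb)
  refine ⟨fun h => ?_, fun h => csInf_le hbdd h⟩
  have hright := ((ProbabilityTheory.cdf ν).right_continuous x).mono Ioi_subset_Ici_self
  refine ge_of_tendsto hright.tendsto ?_
  filter_upwards [self_mem_nhdsWithin] with y hy
  obtain ⟨z, hz, hzy⟩ := exists_lt_of_csInf_lt hne (h.trans_lt hy)
  exact le_trans hz (hmono hzy.le)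

theorem monotoneOn_quantile (ν : Measure ℝ) [IsProbabilityMeasure ν] :
    MonotoneOn (quantile ν) (Ioo 0 1) := fun _ ha _ hb hab =>
  (quantile_le_iff ν ha _).2 (hab.trans ((quantile_le_iff ν hb _).1 le_rfl))

theorem aemeasurable_quantile (ν : Measure ℝ) [IsProbabilityMeasure ν] :
    AEMeasurable (quantile ν) (volume.restrict (Ioo 0 1)) :=
  aemeasurable_restrict_of_monotoneOn measurableSet_Ioo (monotoneOn_quantile ν)

instance isProbabilityMeasure_volume_restrict_Ioo_zero_one :
    IsProbabilityMeasure ((volume : Measure ℝ).restrict (Ioo 0 1)) := ⟨by simp⟩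

theorem volume_restrict_Ioo_zero_one_Iic {c : ℝ} (h1 : c ≤ 1) :
    (volume.restrict (Ioo (0 : ℝ) 1)) (Iic c) = ENNReal.ofReal c := by
  rw [restrict_Ioo_eq_restrict_Ioc, Measure.restrict_apply measurableSet_Iic]
  have : Iic c ∩ Ioc 0 1 = Ioc 0 c := by
    ext y
    simp only [mem_inter_iff, mem_Iic, mem_Ioc]
    constructor
    · rintro ⟨h, h', -⟩
      exact ⟨h', h⟩
    · rintro ⟨h, h'⟩
      exact ⟨h', h, h'.trans h1⟩
  rw [this, Real.volume_Ioc, sub_zero]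

/-- The quantile function transports the uniform distribution on `(0, 1)` to the measure. -/
theorem map_quantile (ν : Measure ℝ) [IsProbabilityMeasure ν] :
    (volume.restrict (Ioo 0 1)).map (quantile ν) = ν := by
  have := Measure.isProbabilityMeasure_map (aemeasurable_quantile ν)
  refine Measure.ext_of_Iic _ _ fun x => ?_
  rw [Measure.map_apply_of_aemeasurable (aemeasurable_quantile ν) measurableSet_Iic]
  have h : (quantile ν ⁻¹' Iic x : Set ℝ) =ᵐ[volume.restrict (Ioo 0 1)] Iic (cdf ν x) := by
    filter_upwards [ae_restrict_mem measurableSet_Ioo] with p hp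
    exact propext (quantile_le_iff ν hp x)
  rw [measure_congr h, volume_restrict_Ioo_zero_one_Iic (c := cdf ν x) measureReal_le_one, cdf,
    ENNReal.ofReal_toReal (measure_ne_top _ _)]

/-- Two real functions with the same law, one below the other, agree almost everywhere. -/
theorem ae_eq_of_ae_le_of_map_eq {Ω : Type*} [MeasurableSpace Ω] {P : Measure Ω}
    [IsFiniteMeasure P] {f g : Ω → ℝ} (hf : AEMeasurable f P) (hg : AEMeasurable g P)
    (hle : f ≤ᵐ[P] g) (hmap : P.map f = P.map g) : f =ᵐ[P] g := by
  have key : ∀ q : ℚ, ∀ᵐ x ∂P, g x ≤ q ↔ f x ≤ q := by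
    intro q
    have hsub : (g ⁻¹' Iic (q : ℝ) : Set Ω) ≤ᵐ[P] f ⁻¹' Iic (q : ℝ) := by
      filter_upwards [hle] with x hx h
      exact hx.trans h
    have hmeas : P (f ⁻¹' Iic (q : ℝ)) ≤ P (g ⁻¹' Iic (q : ℝ)) := by
      rw [← Measure.map_apply_of_aemeasurable hf measurableSet_Iic,
        ← Measure.map_apply_of_aemeasurable hg measurableSet_Iic, hmap]
    have := ae_eq_of_ae_subset_of_measure_ge hsub hmeas
      (hg.nullMeasurableSet_preimage measurableSet_Iic) (measure_ne_top _ _)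
    filter_upwards [this] with x hx
    exact iff_of_eq hx
  filter_upwards [hle, ae_all_iff.2 key] with x hx hq
  refine le_antisymm hx (le_of_forall_gt_imp_ge_of_dense fun a ha => ?_)
  obtain ⟨q, hq1, hq2⟩ := exists_rat_btwn ha
  exact ((hq q).2 hq1.le).trans hq2.le

/-- A function which is monotone off a null subset of `(0, 1)` is almost everywhere the quantile
function of its law. -/
theorem quantile_map_ae_eq {R : ℝ → ℝ} (hR : AEMeasurable R (volume.restrict (Ioo 0 1)))
    {A : Set ℝ} (hA : ∀ᵐ a ∂volume.restrict (Ioo 0 1), a ∈ A) (hmono : MonotoneOn R A) :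
    quantile ((volume.restrict (Ioo 0 1)).map R) =ᵐ[volume.restrict (Ioo 0 1)] R := by
  have := Measure.isProbabilityMeasure_map hR
  refine ae_eq_of_ae_le_of_map_eq (aemeasurable_quantile _) hR ?_ (map_quantile _)
  filter_upwards [hA, ae_restrict_mem measurableSet_Ioo] with a ha ha'
  rw [quantile_le_iff _ ha', cdf, ← ENNReal.ofReal_le_iff_le_toReal (measure_ne_top _ _),
    Measure.map_apply_of_aemeasurable hR measurableSet_Iic,
    ← volume_restrict_Ioo_zero_one_Iic ha'.2.le]
  refine measure_mono_ae ?_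
  filter_upwards [hA] with b hb hba
  exact hmono hb ha hba

/-- The quantile function of the image under an almost everywhere monotone map. -/
theorem quantile_map_ae_eq_comp (μ : Measure ℝ) [IsProbabilityMeasure μ] {T : ℝ → ℝ}
    (hT : Measurable T) {s : Set ℝ} (hs : ∀ᵐ x ∂μ, x ∈ s) (hmono : MonotoneOn T s) :
    quantile (μ.map T) =ᵐ[volume.restrict (Ioo 0 1)] T ∘ quantile μ := by
  have hQ := aemeasurable_quantile μ
  have hs' : ∀ᵐ a ∂volume.restrict (Ioo 0 1), quantile μ a ∈ s :=
    ae_of_ae_map hQ (by rwa [map_quantile])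
  have h := quantile_map_ae_eq (R := T ∘ quantile μ) (hT.comp_aemeasurable hQ)
    (A := Ioo 0 1 ∩ quantile μ ⁻¹' s)
    (by filter_upwards [hs', ae_restrict_mem measurableSet_Ioo] with a h1 h2 using ⟨h2, h1⟩)
    (fun a ha b hb hab => hmono ha.2 hb.2 (monotoneOn_quantile μ ha.1 hb.1 hab))
  rwa [← AEMeasurable.map_map_of_aemeasurable hT.aemeasurable hQ, map_quantile] at h

theorem W2sq_map_map (μ : Measure ℝ) [IsProbabilityMeasure μ] {S T : ℝ → ℝ}
    (hS : Measurable S) (hT : Measurable T) {s : Set ℝ} (hs : ∀ᵐ x ∂μ, x ∈ s)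
    (hSmono : MonotoneOn S s) (hTmono : MonotoneOn T s) :
    W2sq (μ.map S) (μ.map T) = ∫ x, (S x - T x) ^ 2 ∂μ := by
  have h : W2sq (μ.map S) (μ.map T)
      = ∫ a in Ioo (0 : ℝ) 1, (S (quantile μ a) - T (quantile μ a)) ^ 2 := by
    refine integral_congr_ae ?_
    filter_upwards [quantile_map_ae_eq_comp μ hS hs hSmono,
      quantile_map_ae_eq_comp μ hT hs hTmono] with a h1 h2
    simp only [h1, h2, Function.comp_apply]
  rw [h, ← integral_map (f := fun x => (S x - T x) ^ 2) (aemeasurable_quantile μ)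
    ((hS.sub hT).pow_const 2).aestronglyMeasurable, map_quantile]

theorem stmt4 (μ : Measure ℝ) [IsProbabilityMeasure μ]
    (hac : μ ≪ volume) (hmom : Integrable (fun x => x ^ 2) μ)
    (v₀ v₁ : ℝ → ℝ) (h₀meas : Measurable v₀) (h₁meas : Measurable v₁)
    (h₀2 : Integrable (fun x => (v₀ x) ^ 2) μ) (h₁2 : Integrable (fun x => (v₁ x) ^ 2) μ)
    (h₀mon : ∃ s : Set ℝ, MeasurableSet s ∧ μ sᶜ = 0 ∧ MonotoneOn (fun x => x + v₀ x) s)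
    (h₁mon : ∃ s : Set ℝ, MeasurableSet s ∧ μ sᶜ = 0 ∧ MonotoneOn (fun x => x + v₁ x) s)
    (γ : ℝ → Measure ℝ)
    (hγ : ∀ t, γ t = μ.map (fun x => x + ((1 - t) * v₀ x + t * v₁ x))) :
    ∀ s ∈ Icc (0:ℝ) 1, ∀ t ∈ Icc (0:ℝ) 1,
      W2sq (γ s) (γ t) = (s - t) ^ 2 * W2sq (γ 0) (γ 1) := by
  obtain ⟨s₀, -, hs₀, hm₀⟩ := h₀mon
  obtain ⟨s₁, -, hs₁, hm₁⟩ := h₁mon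
  have hae : ∀ᵐ x ∂μ, x ∈ s₀ ∩ s₁ := by
    filter_upwards [mem_ae_iff.2 hs₀, mem_ae_iff.2 hs₁] with x h h' using ⟨h, h'⟩
  have hmeas : ∀ t : ℝ, Measurable fun x => x + ((1 - t) * v₀ x + t * v₁ x) := fun t => by
    fun_prop
  have hmono : ∀ t ∈ Icc (0 : ℝ) 1,
      MonotoneOn (fun x => x + ((1 - t) * v₀ x + t * v₁ x)) (s₀ ∩ s₁) := by
    intro t ht x hx y hy hxy
    have h0 := mul_le_mul_of_nonneg_left (hm₀ hx.1 hy.1 hxy) (sub_nonneg.2 ht.2)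
    have h1 := mul_le_mul_of_nonneg_left (hm₁ hx.2 hy.2 hxy) ht.1
    dsimp only at h0 h1 ⊢
    linarith
  have hW : ∀ s ∈ Icc (0 : ℝ) 1, ∀ t ∈ Icc (0 : ℝ) 1,
      W2sq (γ s) (γ t) = (s - t) ^ 2 * ∫ x, (v₀ x - v₁ x) ^ 2 ∂μ := by
    intro s hs t ht
    rw [hγ, hγ, W2sq_map_map μ (hmeas s) (hmeas t) hae (hmono s hs) (hmono t ht),
      ← integral_const_mul]
    refine integral_congr_ae (.of_forall fun x => ?_)
    ring
  intro s hs t ht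
  rw [hW s hs t ht, hW 0 (by simp) 1 (by simp)]
  ring
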